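/- Let N ≥ 3, p ≥ 2, and let a₁, a₂ ∈ ℝ^N. Suppose φ > 0 on ℝ^N, φ ∈ C²(ℝ^N \ {a₁, a₂}), and V ∈ L¹_loc(ℝ^N) is continuous on ℝ^N \ {a₁, a₂} and satisfies the equality −div(|∇φ|^{p−2}∇φ)(x) = V(x)φ(x)^{p−1} for all x ∈ ℝ^N \ {a₁, a₂}. Then for every u ∈ C_c^∞(ℝ^N \ {a₁, a₂}): ∫_{ℝ^N} |∇u|^p dx − ∫_{ℝ^N} V|u|^p dx ≤ (p(p−1)/2) ∫_{ℝ^N} ( φ|∇(u/φ)| + (|u|/φ)|∇φ| )^{p−2} · φ² |∇(u/φ)|² dx. -/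

import Mathlib

open MeasureTheory

noncomputable section

/-- Divergence of a vector field on Euclidean space. -/
def divg {N : ℕ} (X : EuclideanSpace ℝ (Fin N) → EuclideanSpace ℝ (Fin N))
    (x : EuclideanSpace ℝ (Fin N)) : ℝ :=
  ∑ i, fderiv ℝ X x (EuclideanSpace.single i 1) i

/-- The `p`-Laplacian `Δ_p φ = div(|∇φ|^{p-2} ∇φ)`. -/
def pLap {N : ℕ} (p : ℝ) (φ : EuclideanSpace ℝ (Fin N) → ℝ)
    (x : EuclideanSpace ℝ (Fin N)) : ℝ :=
  divg (fun y => ‖gradient φ y‖ ^ (p - 2) • gradient φ y) x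

end

open scoped Topology RealInnerProductSpace

section PowerField

variable {E : Type*} [NormedAddCommGroup E] [InnerProductSpace ℝ E]

/-- The derivative of `z ↦ ‖z‖ ^ q • z`. -/
noncomputable def normRpowSmulDeriv (q : ℝ) (z : E) : E →L[ℝ] E :=
  ‖z‖ ^ q • ContinuousLinearMap.id ℝ E +
    (q * ‖z‖ ^ (q - 2)) • (innerSL ℝ z).smulRight z

theorem norm_normRpowSmulDeriv_le {q : ℝ} (hq : 0 ≤ q) (z : E) :
    ‖normRpowSmulDeriv q z‖ ≤ (q + 1) * ‖z‖ ^ q := by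
  have hz := norm_nonneg z
  have h1 : ‖‖z‖ ^ q • ContinuousLinearMap.id ℝ E‖ ≤ ‖z‖ ^ q := by
    rw [norm_smul, Real.norm_of_nonneg (by positivity)]
    exact mul_le_of_le_one_right (by positivity) ContinuousLinearMap.norm_id_le
  have h2 : ‖(q * ‖z‖ ^ (q - 2)) • (innerSL ℝ z).smulRight z‖ ≤ q * ‖z‖ ^ q := by
    rw [norm_smul, Real.norm_of_nonneg (by positivity),
      ContinuousLinearMap.norm_smulRight_apply, innerSL_apply_norm, mul_assoc]
    rcases eq_or_lt_of_le hz with h | h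
    · rw [← h]; simp; positivity
    · rw [Real.rpow_sub h, Real.rpow_two]
      refine le_of_eq ?_
      field_simp
  calc _ ≤ _ := norm_add_le _ _
    _ ≤ ‖z‖ ^ q + q * ‖z‖ ^ q := add_le_add h1 h2
    _ = _ := by ring

theorem hasFDerivAt_norm_rpow_smul {q : ℝ} (hq : 0 ≤ q) (z : E) :
    HasFDerivAt (fun w : E => ‖w‖ ^ q • w) (normRpowSmulDeriv q z) z := by
  rcases eq_or_lt_of_le hq with rfl | hq'
  · simpa [normRpowSmulDeriv] using! hasFDerivAt_id z
  by_cases hz : z = 0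
  · subst hz
    have h0 : normRpowSmulDeriv q (0 : E) = 0 := by
      simp [normRpowSmulDeriv, Real.zero_rpow hq'.ne']
    rw [h0]
    refine .of_isLittleO ?_
    have h : (fun w : E => ‖w‖ ^ q • w) =o[𝓝 0] (fun w : E => (1 : ℝ) • w) := by
      refine Asymptotics.IsLittleO.smul_isBigO ?_ (Asymptotics.isBigO_refl _ _)
      rw [Asymptotics.isLittleO_const_iff one_ne_zero]
      have := (continuous_norm (E := E)).continuousAt (x := 0) |>.rpow_const (p := q) (.inr hq)
      simpa [ContinuousAt, Real.zero_rpow hq'.ne'] using this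
    simpa using h
  · have h1 : HasFDerivAt (fun w : E => ‖w‖ ^ q) ((q * ‖z‖ ^ (q - 2)) • innerSL ℝ z) z := by
      apply HasStrictFDerivAt.hasFDerivAt
      convert! (hasStrictFDerivAt_norm_sq z).rpow_const (p := q / 2) (by simp [hz]) using 0
      simp_rw [← Real.rpow_natCast_mul (norm_nonneg _), ← Nat.cast_smul_eq_nsmul ℝ, smul_smul]
      ring_nf
    refine (h1.smul (hasFDerivAt_id z)).congr_fderiv ?_
    ext w
    simp [normRpowSmulDeriv, smul_smul]

theorem contDiff_norm_rpow_smul {q : ℝ} (hq : 0 ≤ q) :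
    ContDiff ℝ 1 (fun w : E => ‖w‖ ^ q • w) := by
  rcases eq_or_lt_of_le hq with rfl | hq'
  · simpa using! contDiff_id
  refine contDiff_one_iff_hasFDerivAt.2
    ⟨normRpowSmulDeriv q, ?_, fun z => hasFDerivAt_norm_rpow_smul hq z⟩
  rw [continuous_iff_continuousAt]
  intro z
  by_cases hz : z = 0
  · subst hz
    have h0 : normRpowSmulDeriv q (0 : E) = 0 := by
      simp [normRpowSmulDeriv, Real.zero_rpow hq'.ne']
    rw [ContinuousAt, h0]
    refine squeeze_zero_norm (fun w => norm_normRpowSmulDeriv_le hq w) ?_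
    have := ((continuous_norm (E := E)).continuousAt (x := 0) |>.rpow_const (p := q)
      (.inr hq)).const_mul (q + 1)
    simpa [ContinuousAt, Real.zero_rpow hq'.ne'] using this
  · have hz' : ‖z‖ ≠ 0 := norm_ne_zero_iff.2 hz
    have hc (r : ℝ) : ContinuousAt (fun w : E => ‖w‖ ^ r) z :=
      continuous_norm.continuousAt.rpow_const (.inl hz')
    have hs : Continuous fun w : E => (innerSL ℝ w).smulRight w :=
      (ContinuousLinearMap.smulRightL ℝ E E).continuous₂.comp
        ((innerSL ℝ).continuous.prodMk continuous_id)
    exact ((hc q).smul continuousAt_const).add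
      (((hc (q - 2)).const_mul q).smul hs.continuousAt)

/-- Second-order Taylor bound for `z ↦ ‖z‖ ^ p`. -/
theorem norm_add_rpow_le {p : ℝ} (hp : 2 ≤ p) (X Y : E) :
    ‖X + Y‖ ^ p ≤ ‖X‖ ^ p + p * (‖X‖ ^ (p - 2) * ⟪X, Y⟫) +
      p * (p - 1) / 2 * ((‖Y‖ + ‖X‖) ^ (p - 2) * ‖Y‖ ^ 2) := by
  set M := (‖Y‖ + ‖X‖) ^ (p - 2)
  set h : ℝ → ℝ := fun t => ‖X + t • Y‖ ^ p - p * (‖X‖ ^ (p - 2) * ⟪X, Y⟫) * t -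
    p * (p - 1) / 2 * (M * ‖Y‖ ^ 2) * t ^ 2 with hh
  have hline (t : ℝ) : HasDerivAt (fun t : ℝ => X + t • Y) Y t := by
    simpa using ((hasDerivAt_id t).smul_const Y).const_add X
  have hder (t : ℝ) : HasDerivAt h (p * ⟪‖X + t • Y‖ ^ (p - 2) • (X + t • Y), Y⟫ -
      p * (‖X‖ ^ (p - 2) * ⟪X, Y⟫) - p * (p - 1) * (M * ‖Y‖ ^ 2) * t) t := by
    have h1 := (hasFDerivAt_norm_rpow (X + t • Y) (p := p) (by linarith)).comp_hasDerivAt t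
      (hline t)
    have h2 := (hasDerivAt_id t).const_mul (p * (‖X‖ ^ (p - 2) * ⟪X, Y⟫))
    have h3 := ((hasDerivAt_id t).pow 2).const_mul (p * (p - 1) / 2 * (M * ‖Y‖ ^ 2))
    refine ((h1.sub h2).sub h3).congr_deriv ?_
    simp only [FunLike.coe_smul, Pi.smul_apply, innerSL_apply_apply, smul_eq_mul,
      real_inner_smul_left, id]
    norm_num
    ring
  have hlip (t : ℝ) (ht0 : 0 ≤ t) (ht1 : t ≤ 1) :
      ‖‖X + t • Y‖ ^ (p - 2) • (X + t • Y) - ‖X‖ ^ (p - 2) • X‖ ≤ (p - 1) * M * (t * ‖Y‖) := by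
    have hseg : segment ℝ X (X + t • Y) ⊆ Metric.closedBall 0 (‖Y‖ + ‖X‖) := by
      refine (convex_closedBall _ _).segment_subset ?_ ?_
      · simp
      · simp only [mem_closedBall_zero_iff]
        calc _ ≤ ‖X‖ + ‖t • Y‖ := norm_add_le _ _
          _ ≤ ‖X‖ + 1 * ‖Y‖ := by
            rw [norm_smul, Real.norm_of_nonneg ht0]; gcongr
          _ = _ := by ring
    have := (convex_segment X (X + t • Y)).norm_image_sub_le_of_norm_hasFDerivWithin_le
      (f := fun w : E => ‖w‖ ^ (p - 2) • w) (C := (p - 1) * M)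
      (fun w _ => (hasFDerivAt_norm_rpow_smul (q := p - 2) (by linarith) w).hasFDerivWithinAt)
      (fun w hw => ?_) (left_mem_segment ℝ _ _) (right_mem_segment ℝ _ _)
    · simpa [norm_smul, abs_of_nonneg ht0] using this
    · have hw' : ‖w‖ ≤ ‖Y‖ + ‖X‖ := by simpa using hseg hw
      refine (norm_normRpowSmulDeriv_le (by linarith) w).trans ?_
      have : ‖w‖ ^ (p - 2) ≤ M := Real.rpow_le_rpow (norm_nonneg _) hw' (by linarith)
      have hp1 : p - 2 + 1 = p - 1 := by ring
      rw [hp1]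
      exact mul_le_mul_of_nonneg_left this (by linarith)
  have hanti : AntitoneOn h (Set.Icc 0 1) := by
    refine antitoneOn_of_deriv_nonpos (convex_Icc 0 1)
      (fun t _ => (hder t).continuousAt.continuousWithinAt)
      (fun t _ => (hder t).differentiableAt.differentiableWithinAt) fun t ht => ?_
    rw [interior_Icc] at ht
    rw [(hder t).deriv]
    have h1 := real_inner_le_norm (‖X + t • Y‖ ^ (p - 2) • (X + t • Y) - ‖X‖ ^ (p - 2) • X) Y
    rw [inner_sub_left, real_inner_smul_left X] at h1
    have h2 := mul_le_mul_of_nonneg_right (hlip t ht.1.le ht.2.le) (norm_nonneg Y)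
    have h3 := mul_le_mul_of_nonneg_left (h1.trans h2) (by linarith : 0 ≤ p)
    linarith
  have := hanti (Set.left_mem_Icc.2 zero_le_one) (Set.right_mem_Icc.2 zero_le_one) zero_le_one
  simp only [hh, one_smul, zero_smul, add_zero] at this
  linarith

end PowerField

section Divergence

variable {N : ℕ}

local notation "E" => EuclideanSpace ℝ (Fin N)

theorem divg_eq_zero_of_eventuallyEq_zero {Z : E → E} {x : E} (h : Z =ᶠ[𝓝 x] 0) :
    divg Z x = 0 := by
  simp [divg, h.fderiv_eq]

theorem divg_smul {ψ : E → ℝ} {W : E → E} {x : E} (hψ : DifferentiableAt ℝ ψ x)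
    (hW : DifferentiableAt ℝ W x) :
    divg (fun y => ψ y • W y) x = ψ x * divg W x + fderiv ℝ ψ x (W x) := by
  have hs : W x = ∑ i, W x i • EuclideanSpace.single i (1 : ℝ) := by
    ext j
    simp [Finset.sum_apply, Pi.single_apply]
  simp only [divg, fderiv_fun_smul hψ hW]
  conv_rhs => rw [hs, map_sum]
  simp [Finset.sum_add_distrib, Finset.mul_sum, mul_comm]

theorem continuous_divg {Z : E → E} (hZ : ContDiff ℝ 1 Z) : Continuous (divg Z) := by
  have := hZ.continuous_fderiv one_ne_zero
  unfold divg
  fun_prop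

/-- The divergence of a compactly supported `C¹` field integrates to zero. -/
theorem integral_divg_eq_zero {Z : E → E} (hZ : ContDiff ℝ 1 Z) (hc : HasCompactSupport Z) :
    ∫ x, divg Z x = 0 := by
  have hf := hZ.continuous_fderiv one_ne_zero
  have hcomp (i : Fin N) : Integrable (fun x => fderiv ℝ Z x (EuclideanSpace.single i 1)) :=
    Continuous.integrable_of_hasCompactSupport (by fun_prop)
      ((hc.fderiv ℝ).comp_left (g := fun L : E →L[ℝ] E => L (EuclideanSpace.single i 1)) rfl)
  have hint (i : Fin N) : ∫ x, fderiv ℝ Z x (EuclideanSpace.single i 1) = 0 := by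
    have := integral_smul_fderiv_eq_neg_fderiv_smul_of_integrable (μ := (volume : Measure E))
      (f := fun _ : E => (1 : ℝ)) (g := Z) (v := EuclideanSpace.single i 1)
      (by simp) (by simpa using hcomp i)
      (by simpa using hZ.continuous.integrable_of_hasCompactSupport hc)
      (fun _ _ => by fun_prop) (fun x _ => hZ.differentiable one_ne_zero x)
    simpa using this
  unfold divg
  rw [integral_finsetSum _ fun i _ => by
    simpa using (EuclideanSpace.proj (𝕜 := ℝ) i).integrable_comp (hcomp i)]
  refine Finset.sum_eq_zero fun i _ => ?_
  have := (EuclideanSpace.proj (𝕜 := ℝ) i).integral_comp_comm (hcomp i)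
  rw [hint i] at this
  simpa using this

theorem ContDiffOn.gradient_of_isOpen {f : E → ℝ} {S : Set E} (hf : ContDiffOn ℝ 2 f S)
    (hS : IsOpen S) : ContDiffOn ℝ 1 (gradient f) S := by
  have h := hf.fderiv_of_isOpen hS (m := 1) (by norm_num)
  rw [contDiffOn_euclidean]
  intro i
  have : (fun x => gradient f x i) = fun x => fderiv ℝ f x (EuclideanSpace.single i 1) := by
    ext x
    rw [← inner_gradient_left, EuclideanSpace.inner_single_right]
    simp
  rw [this]
  exact h.clm_apply contDiffOn_const

theorem continuous_gradient {f : E → ℝ} (hf : ContDiff ℝ 1 f) : Continuous (gradient f) :=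
  (InnerProductSpace.toDual ℝ E).symm.continuous.comp (hf.continuous_fderiv one_ne_zero)

/-- Pointwise Picone-type inequality: with `v = u / φ` and
`Z = |v|^p φ |∇φ|^{p-2} ∇φ`, the quantity `|∇u|^p` is controlled by `div Z - |v|^p φ Δ_p φ`. -/
theorem norm_gradient_mul_rpow_le {p : ℝ} (hp : 2 ≤ p) {φ v : E → ℝ} {x : E}
    (hφ0 : 0 ≤ φ x) (hφ : DifferentiableAt ℝ φ x) (hv : DifferentiableAt ℝ v x)
    (hW : DifferentiableAt ℝ (fun y => ‖gradient φ y‖ ^ (p - 2) • gradient φ y) x) :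
    ‖gradient (fun y => v y * φ y) x‖ ^ p ≤
      divg (fun y => (|v y| ^ p * φ y) • ‖gradient φ y‖ ^ (p - 2) • gradient φ y) x
        - |v x| ^ p * φ x * pLap p φ x +
      p * (p - 1) / 2 * ((φ x * ‖gradient v x‖ + |v x| * ‖gradient φ x‖) ^ (p - 2) *
        (φ x ^ 2 * ‖gradient v x‖ ^ 2)) := by
  have hg : gradient (fun y => v y * φ y) x = v x • gradient φ x + φ x • gradient v x := by
    refine ext_inner_right ℝ fun w => ?_
    rw [inner_gradient_left, inner_add_left, real_inner_smul_left, real_inner_smul_left,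
      inner_gradient_left, inner_gradient_left, fderiv_fun_mul hv hφ]
    simp
  have hvp : HasFDerivAt (fun y => |v y| ^ p) ((p * |v x| ^ (p - 2) * v x) • fderiv ℝ v x) x :=
    (hasDerivAt_abs_rpow (v x) (by linarith)).comp_hasFDerivAt x hv.hasFDerivAt
  have hψ := hvp.fun_mul hφ.hasFDerivAt
  have hdiv : divg (fun y => (|v y| ^ p * φ y) • ‖gradient φ y‖ ^ (p - 2) • gradient φ y) x
      = |v x| ^ p * φ x * pLap p φ x + ‖gradient φ x‖ ^ (p - 2) *
        (|v x| ^ p * ‖gradient φ x‖ ^ 2 +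
          φ x * (p * |v x| ^ (p - 2) * v x) * ⟪gradient φ x, gradient v x⟫) := by
    rw [divg_smul hψ.differentiableAt hW, hψ.fderiv]
    simp only [pLap, map_smul, FunLike.coe_add, FunLike.coe_smul, Pi.add_apply, Pi.smul_apply,
      smul_eq_mul, ← inner_gradient_left, real_inner_self_eq_norm_sq,
      real_inner_comm (gradient φ x) (gradient v x)]
    ring
  have hsplit {a : ℝ} (ha : 0 ≤ a) : a ^ p = a ^ (p - 2) * a ^ 2 := by
    rw [← Real.rpow_two, ← Real.rpow_add' ha (by linarith)]
    ring_nf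
  have key := norm_add_rpow_le hp (v x • gradient φ x) (φ x • gradient v x)
  rw [← hg] at key
  simp only [norm_smul, Real.norm_eq_abs, abs_of_nonneg hφ0, real_inner_smul_left,
    real_inner_smul_right] at key
  rw [Real.mul_rpow (abs_nonneg _) (norm_nonneg _),
    Real.mul_rpow (abs_nonneg _) (norm_nonneg _), hsplit (norm_nonneg (gradient φ x)), mul_pow] at key
  rw [hdiv]
  linarith

end Divergence

theorem ContinuousOn.continuous_of_eqOn_zero {X : Type*} [TopologicalSpace X] {K S : Set X}
    {f : X → ℝ} (hf : ContinuousOn f S) (hS : IsOpen S) (hK : IsClosed K) (hKS : K ⊆ S)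
    (h0 : ∀ x ∉ K, f x = 0) : Continuous f := by
  refine continuous_iff_continuousAt.2 fun x => ?_
  by_cases hx : x ∈ K
  · exact hf.continuousAt (hS.mem_nhds (hKS hx))
  · have : f =ᶠ[𝓝 x] fun _ => 0 := by
      filter_upwards [hK.isOpen_compl.mem_nhds hx] with y hy using h0 y hy
    exact continuousAt_const.congr this.symm

/-- if `φ > 0` on `ℝ^N` is `C²` away from the two poles and solves
`-Δ_p φ = V φ^{p-1}` there (with `V ∈ L¹_loc` continuous away from the poles), then for every
`u ∈ C_c^∞(ℝ^N \ {a₁, a₂})`: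
`∫ |∇u|^p - ∫ V |u|^p ≤ (p(p-1)/2) ∫ (φ|∇(u/φ)| + (|u|/φ)|∇φ|)^{p-2} φ² |∇(u/φ)|²`. -/
theorem hardy_reverse_inequality (N : ℕ) (hN : 3 ≤ N) (p : ℝ) (hp : 2 ≤ p)
    (a₁ a₂ : EuclideanSpace ℝ (Fin N))
    (φ V : EuclideanSpace ℝ (Fin N) → ℝ)
    (hφpos : ∀ x, 0 < φ x)
    (hφC2 : ContDiffOn ℝ 2 φ ({a₁, a₂} : Set (EuclideanSpace ℝ (Fin N)))ᶜ)
    (hVloc : LocallyIntegrable V volume)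
    (hVcont : ContinuousOn V ({a₁, a₂} : Set (EuclideanSpace ℝ (Fin N)))ᶜ)
    (heq : ∀ x ∉ ({a₁, a₂} : Set (EuclideanSpace ℝ (Fin N))),
      -pLap p φ x = V x * φ x ^ (p - 1))
    (u : EuclideanSpace ℝ (Fin N) → ℝ) (hu : ContDiff ℝ (⊤ : ℕ∞) u)
    (hcpt : HasCompactSupport u)
    (hsupp : tsupport u ⊆ ({a₁, a₂} : Set (EuclideanSpace ℝ (Fin N)))ᶜ) :
    (∫ x, ‖gradient u x‖ ^ p) - ∫ x, V x * |u x| ^ p ≤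
      p * (p - 1) / 2 *
        ∫ x, (φ x * ‖gradient (fun y => u y / φ y) x‖ +
            |u x| / φ x * ‖gradient φ x‖) ^ (p - 2) *
          (φ x ^ 2 * ‖gradient (fun y => u y / φ y) x‖ ^ 2) := by
  set S : Set (EuclideanSpace ℝ (Fin N)) := ({a₁, a₂} : Set (EuclideanSpace ℝ (Fin N)))ᶜ
  have hS : IsOpen S := (Set.toFinite _).isClosed.isOpen_compl
  set v : EuclideanSpace ℝ (Fin N) → ℝ := fun y => u y / φ y with hv_def
  set W : EuclideanSpace ℝ (Fin N) → EuclideanSpace ℝ (Fin N) :=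
    fun y => ‖gradient φ y‖ ^ (p - 2) • gradient φ y
  set Z : EuclideanSpace ℝ (Fin N) → EuclideanSpace ℝ (Fin N) :=
    fun y => (|v y| ^ p * φ y) • W y with hZ_def
  have hp0 : p ≠ 0 := by linarith
  have hφne (x) : φ x ≠ 0 := (hφpos x).ne'
  have hu1 : ContDiff ℝ 1 u := hu.of_le (by exact_mod_cast le_top)
  have hφ1 : ContDiffOn ℝ 1 φ S := hφC2.of_le (by norm_num)
  have hgφ : ContDiffOn ℝ 1 (gradient φ) S := hφC2.gradient_of_isOpen hS
  have hW : ContDiffOn ℝ 1 W S :=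
    (contDiff_norm_rpow_smul (q := p - 2) (by linarith)).comp_contDiffOn hgφ
  have hvS : ContDiffOn ℝ 1 v S := hu1.contDiffOn.div hφ1 fun x _ => hφne x
  have hu_nhds {x} (hx : x ∉ tsupport u) : ∀ᶠ y in 𝓝 x, u y = 0 :=
    notMem_tsupport_iff_eventuallyEq.1 hx
  have hv0 {x} (hx : x ∉ tsupport u) : v =ᶠ[𝓝 x] fun _ => 0 := by
    filter_upwards [hu_nhds hx] with y hy
    simp [hv_def, hy]
  have hv : ContDiff ℝ 1 v := contDiff_iff_contDiffAt.2 fun x => by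
    by_cases hx : x ∈ tsupport u
    · exact hvS.contDiffAt (hS.mem_nhds (hsupp hx))
    · exact contDiffAt_const.congr_of_eventuallyEq (hv0 hx)
  have hZ0 {x} (hx : x ∉ tsupport u) : Z =ᶠ[𝓝 x] 0 := by
    filter_upwards [hu_nhds hx] with y hy
    simp [hZ_def, hv_def, hy, Real.zero_rpow hp0]
  have hZS : ContDiffOn ℝ 1 Z S :=
    (((contDiff_norm_rpow (by linarith : 1 < p)).comp hv).contDiffOn.mul hφ1).smul hW
  have hZ : ContDiff ℝ 1 Z := contDiff_iff_contDiffAt.2 fun x => by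
    by_cases hx : x ∈ tsupport u
    · exact hZS.contDiffAt (hS.mem_nhds (hsupp hx))
    · exact contDiffAt_const.congr_of_eventuallyEq (hZ0 hx)
  have hZc : HasCompactSupport Z :=
    HasCompactSupport.intro hcpt fun x hx => (hZ0 hx).eq_of_nhds
  have hu0 {x} (hx : x ∉ tsupport u) : u x = 0 := image_eq_zero_of_notMem_tsupport hx
  have hgu0 {x} (hx : x ∉ tsupport u) : gradient u x = 0 := by
    rw [Filter.EventuallyEq.gradient_eq (hu_nhds hx), gradient_fun_const]
  have hgv0 {x} (hx : x ∉ tsupport u) : gradient v x = 0 := by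
    rw [(hv0 hx).gradient_eq, gradient_fun_const]
  have hint {f : EuclideanSpace ℝ (Fin N) → ℝ} (hf : ContinuousOn f S)
      (h0 : ∀ x ∉ tsupport u, f x = 0) : Integrable f :=
    (hf.continuous_of_eqOn_zero hS (isClosed_tsupport u) hsupp h0).integrable_of_hasCompactSupport
      (HasCompactSupport.intro hcpt h0)
  have hp2 : 0 ≤ p - 2 := by linarith
  have hI1 : Integrable fun x => ‖gradient u x‖ ^ p :=
    hint ((continuous_gradient hu1).norm.rpow_const fun _ => .inr (by linarith)).continuousOn
      fun x hx => by simp [hgu0 hx, Real.zero_rpow hp0]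
  have hI2 : Integrable fun x => V x * |u x| ^ p :=
    hint (hVcont.mul (hu1.continuous.abs.rpow_const fun _ => .inr (by linarith)).continuousOn)
      fun x hx => by simp [hu0 hx, Real.zero_rpow hp0]
  have hI3 : Integrable fun x => (φ x * ‖gradient v x‖ + |u x| / φ x * ‖gradient φ x‖) ^ (p - 2) *
      (φ x ^ 2 * ‖gradient v x‖ ^ 2) := by
    have h1 := hφ1.continuousOn
    have h2 := (continuous_gradient hv).norm.continuousOn (s := S)
    have h3 := hu1.continuous.abs.continuousOn.div h1 fun x _ => hφne x
    exact hint ((((h1.mul h2).add (h3.mul hgφ.continuousOn.norm)).rpow_const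
      fun _ _ => .inr hp2).mul ((h1.pow 2).mul (h2.pow 2)))
      fun x hx => by simp [hgv0 hx]
  have hI4 : Integrable (divg Z) :=
    hint (continuous_divg hZ).continuousOn
      fun x hx => divg_eq_zero_of_eventuallyEq_zero (hZ0 hx)
  have huv : u = fun y => v y * φ y := by
    ext y
    simp [hv_def, hφne y]
  have hle (x) : ‖gradient u x‖ ^ p - V x * |u x| ^ p ≤ divg Z x + p * (p - 1) / 2 *
      ((φ x * ‖gradient v x‖ + |u x| / φ x * ‖gradient φ x‖) ^ (p - 2) *
        (φ x ^ 2 * ‖gradient v x‖ ^ 2)) := by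
    by_cases hx : x ∈ tsupport u
    · have hxS := hsupp hx
      have hnhds := hS.mem_nhds hxS
      have key := norm_gradient_mul_rpow_le hp (hφpos x).le
        ((hφ1.contDiffAt hnhds).differentiableAt one_ne_zero)
        (hv.differentiable one_ne_zero x)
        ((hW.contDiffAt hnhds).differentiableAt one_ne_zero)
      rw [← huv] at key
      have habs : |u x| / φ x = |v x| := by
        simp [hv_def, abs_div, abs_of_pos (hφpos x)]
      have hpow : |v x| ^ p * φ x * pLap p φ x = -(V x * |u x| ^ p) := by
        have h1 : |u x| ^ p = |v x| ^ p * (φ x ^ (p - 1) * φ x) := by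
          rw [← Real.rpow_add_one (hφne x), sub_add_cancel,
            ← Real.mul_rpow (abs_nonneg _) (hφpos x).le, ← habs, div_mul_cancel₀ _ (hφne x)]
        rw [h1]
        linear_combination (-(|v x| ^ p * φ x)) * heq x hxS
      rw [habs]
      rw [hpow] at key
      linarith
    · rw [divg_eq_zero_of_eventuallyEq_zero (hZ0 hx)]
      simp [hgu0 hx, hu0 hx, hgv0 hx, Real.zero_rpow hp0]
  have hmono := integral_mono (hI1.sub hI2) (hI4.add (hI3.const_mul (p * (p - 1) / 2))) hle
  rw [integral_sub' hI1 hI2, integral_add' hI4 (hI3.const_mul _), integral_divg_eq_zero hZ hZc,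
    zero_add, integral_const_mul] at hmono
  exact hmono
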